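/- Fix an integer n ≥ 3. Under the Tajima distribution π on COM_n, the variance of the internal tree length is Var_π(φ) = E_π[φ²] − (E_π[φ])² = n(n+1)(n−3)/90. -/

import Mathlib

open Finset

/-- `p` is an unlabeled constrained ordered matching: each `p k` is a multiset of size two
over the symbols `Fin (n-1)` (symbol `0` stands for a leaf, symbol `j ≠ 0` for the internal
label `j`); across all pairs the symbol `0` appears `n` times and each internal label once;
and the internal label `j` may only appear in pair `p k` (1-indexed pair `k+1`) when 
`j < k + 1`, i.e. `j ≤ k`. -/
def IsUCOMraw (n : ℕ) (p : Fin (n - 1) → Multiset (Fin (n - 1))) : Prop :=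
  (∀ k, Multiset.card (p k) = 2) ∧
  (∀ s : Fin (n - 1), (∑ k, (p k).count s) = if (s : ℕ) = 0 then n else 1) ∧
  (∀ (j k : Fin (n - 1)), (j : ℕ) ≠ 0 → j ∈ p k → (j : ℕ) ≤ (k : ℕ))

instance (n : ℕ) : DecidablePred (IsUCOMraw n) := fun _ => by
  unfold IsUCOMraw; infer_instance

instance (n : ℕ) :
    DecidablePred (fun p : Fin (n - 1) → Sym (Fin (n - 1)) 2 =>
      IsUCOMraw n (fun k => (p k : Multiset (Fin (n - 1))))) := fun _ => by
  infer_instance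

/-- The set of unlabeled constrained ordered matchings `COM_n`; each pair is stored as an
unordered pair with possible repetition (`Sym _ 2`), with the validity predicate imposed on
the underlying multisets. -/
abbrev UCOM (n : ℕ) : Type :=
  {p : Fin (n - 1) → Sym (Fin (n - 1)) 2 //
    IsUCOMraw n (fun k => (p k : Multiset (Fin (n - 1))))}

/-- The sequence of size-two multisets underlying an unlabeled constrained ordered matching. -/
def uraw (n : ℕ) (x : UCOM n) : Fin (n - 1) → Multiset (Fin (n - 1)) :=
  fun k => (x.val k : Multiset (Fin (n - 1)))

/-- Index of the pair `p_k` (1-indexed `k ∈ {1,…,n-2}`) as an element of `Fin (n-1)`. -/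
def idx1 {n : ℕ} (k : Fin (n - 2)) : Fin (n - 1) := ⟨k, by have := k.isLt; omega⟩

/-- Index of the pair `p_{k+1}` as an element of `Fin (n-1)`. -/
def idx2 {n : ℕ} (k : Fin (n - 2)) : Fin (n - 1) := ⟨(k : ℕ) + 1, by have := k.isLt; omega⟩

/-- Result of exchanging symbol `l1` from pair `k` with symbol `l2` from pair `k+1`. -/
def uswapFun (n : ℕ) (p : Fin (n - 1) → Multiset (Fin (n - 1))) (k : Fin (n - 2))
    (l1 l2 : Fin (n - 1)) : Fin (n - 1) → Multiset (Fin (n - 1)) :=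
  fun i =>
    if i = idx1 k then l2 ::ₘ (p (idx1 k)).erase l1
    else if i = idx2 k then l1 ::ₘ (p (idx2 k)).erase l2
    else p i

/-- The state obtained from `x` when attempting to exchange `l1 ∈ p_k` with `l2 ∈ p_{k+1}`:
the swap is performed if it yields a valid constrained ordered matching,
otherwise the chain stays at `x`. -/
def uswapDest (n : ℕ) (x : UCOM n) (k : Fin (n - 2)) (l1 l2 : Fin (n - 1)) :
    Fin (n - 1) → Multiset (Fin (n - 1)) :=
  if IsUCOMraw n (uswapFun n (uraw n x) k l1 l2) then uswapFun n (uraw n x) k l1 l2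
  else uraw n x

/-- Transition matrix of the adjacent-swap Markov chain on `COM_n`:
pick `k ∈ {1,…,n-2}` uniformly, pick `l1` uniformly from the multiset `p_k`
and `l2` uniformly from the multiset `p_{k+1}` (each of the two slots of a pair
with probability 1/2), and swap them if allowed. -/
noncomputable def PU (n : ℕ) (x y : UCOM n) : ℝ :=
  (1 / ((n : ℝ) - 2)) * ∑ k : Fin (n - 2),
    ((uraw n x (idx1 k)).map (fun l1 =>
      ((uraw n x (idx2 k)).map (fun l2 =>
        (1 / 4 : ℝ) * (if uswapDest n x k l1 l2 = uraw n y then 1 else 0))).sum)).sum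

/-- The adjacent-swap transition matrix on `COM_n` as a matrix. -/
noncomputable def PUmat (n : ℕ) : Matrix (UCOM n) (UCOM n) ℝ := Matrix.of (PU n)

/-- The number of cherries of `T`: pairs all of whose elements are the leaf symbol `0`,
i.e. pairs equal to `{0,0}`. -/
def cherries (n : ℕ) (T : UCOM n) : ℕ :=
  (Finset.univ.filter (fun k : Fin (n - 1) => ∀ a ∈ uraw n T k, (a : ℕ) = 0)).card

/-- The Tajima coalescent distribution on `COM_n`. -/
noncomputable def tajima (n : ℕ) (T : UCOM n) : ℝ :=
  (2 : ℝ) ^ (n - cherries n T - 1) / (Nat.factorial (n - 1))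

/-- The (1-indexed, shifted down by one) index of the pair containing the internal label `j`:
`Ix n x j` is the unique `k` (0-indexed) with `j ∈ p_{k+1}`, so that `I_x(j) = Ix n x j + 1`. -/
noncomputable def Ix (n : ℕ) (x : UCOM n) (j : Fin (n - 1)) : ℕ :=
  sInf {k : ℕ | ∃ h : k < n - 1, j ∈ uraw n x ⟨k, h⟩}

/-- The internal tree length `φ(x) = ∑_{j=1}^{n-2} (I_x(j) - j)`. -/
noncomputable def itl (n : ℕ) (x : UCOM n) : ℤ :=
  ∑ j ∈ Finset.univ.filter (fun j : Fin (n - 1) => (j : ℕ) ≠ 0),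
    ((Ix n x j : ℤ) + 1 - (j : ℤ))


def cnt {t : ℕ} (f : Fin t → ℕ) (q : ℕ) : ℕ := ∑ i, if f i = q then 1 else 0

def Dw (c : ℕ) : ℝ := (Nat.descFactorial 2 c : ℝ)

lemma Dw_zero : Dw 0 = 1 := by simp [Dw]
lemma Dw_one : Dw 1 = 2 := by simp [Dw]
lemma Dw_two : Dw 2 = 2 := by norm_num [Dw, Nat.descFactorial]
lemma Dw_ge (c : ℕ) (h : 3 ≤ c) : Dw c = 0 := by
  simp [Dw, Nat.descFactorial_eq_zero_iff_lt]; omega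

lemma Dw_succ (c : ℕ) : Dw (c + 1) = Dw c * (2 - c) := by
  rcases Nat.lt_or_ge c 3 with h | h
  · interval_cases c <;> norm_num [Dw, Nat.descFactorial]
  · rw [Dw_ge c h, Dw_ge _ (by omega)]; simp

def wt (t : ℕ) (f : Fin t → ℕ) : ℝ := ∏ q ∈ range (t + 1), Dw (cnt f q)

def SS (t : ℕ) : Finset (Fin t → ℕ) := Fintype.piFinset (fun i => range ((i : ℕ) + 1))

lemma mem_SS {t : ℕ} {f : Fin t → ℕ} : f ∈ SS t ↔ ∀ i, f i ≤ i := by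
  simp [SS]

lemma cnt_snoc {t : ℕ} (f : Fin t → ℕ) (a q : ℕ) :
    cnt (Fin.snoc f a : Fin (t + 1) → ℕ) q = cnt f q + if a = q then 1 else 0 := by
  unfold cnt
  rw [Fin.sum_univ_castSucc]
  simp only [Fin.snoc_castSucc, Fin.snoc_last]

lemma cnt_ge {t : ℕ} {f : Fin t → ℕ} (hf : f ∈ SS t) {q : ℕ} (hq : t ≤ q) : cnt f q = 0 := by
  rw [mem_SS] at hf
  unfold cnt
  refine Finset.sum_eq_zero fun i _ => ?_
  have := hf i
  have := i.isLt
  rw [if_neg (by omega)]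

lemma wt_snoc {t : ℕ} {f : Fin t → ℕ} (hf : f ∈ SS t) {a : ℕ} (ha : a ∈ range (t + 1)) :
    wt (t + 1) (Fin.snoc f a : Fin (t + 1) → ℕ) = wt t f * (2 - cnt f a) := by
  have ha' := Finset.mem_range.1 ha
  unfold wt
  rw [Finset.prod_range_succ, cnt_snoc, cnt_ge hf (by omega), if_neg (by omega)]
  simp only [add_zero, Dw_zero, mul_one]
  have : ∀ q ∈ range (t + 1), Dw (cnt (Fin.snoc f a : Fin (t + 1) → ℕ) q)
      = Dw (cnt f q) * (if a = q then (2 - (cnt f q : ℝ)) else 1) := by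
    intro q _
    rw [cnt_snoc]
    split_ifs
    · exact Dw_succ _
    · simp
  rw [Finset.prod_congr rfl this, Finset.prod_mul_distrib, Finset.prod_ite_eq, if_pos ha]

lemma sum_SS_succ (t : ℕ) (H : (Fin (t + 1) → ℕ) → ℝ) :
    ∑ g ∈ SS (t + 1), H g
      = ∑ f ∈ SS t, ∑ a ∈ range (t + 1), H (Fin.snoc f a : Fin (t + 1) → ℕ) := by
  rw [← Finset.sum_product']
  refine Finset.sum_bij' (fun g _ => ((fun i => g (Fin.castSucc i) : Fin t → ℕ), g (Fin.last t)))
    (fun p _ => (Fin.snoc p.1 p.2 : Fin (t + 1) → ℕ)) ?_ ?_ ?_ ?_ ?_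
  · intro g hg
    rw [mem_SS] at hg
    simp only [Finset.mem_product, mem_SS, Finset.mem_range]
    refine ⟨fun i => by simpa using hg i.castSucc, ?_⟩
    have := hg (Fin.last t)
    simp at this; omega
  · rintro ⟨f, a⟩ h
    simp only [Finset.mem_product, mem_SS, Finset.mem_range] at h
    rw [mem_SS]
    intro i
    refine Fin.lastCases ?_ (fun i => ?_) i
    · simp; omega
    · simpa using h.1 i
  · intro g _
    ext i
    refine Fin.lastCases ?_ (fun i => ?_) i <;> simp
  · rintro ⟨f, a⟩ _
    simp
  · intro g _
    congr 1
    ext i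
    refine Fin.lastCases ?_ (fun i => ?_) i <;> simp

lemma sum_cnt {t : ℕ} {f : Fin t → ℕ} (hf : f ∈ SS t) (h : ℕ → ℝ) :
    ∑ a ∈ range (t + 1), (cnt f a : ℝ) * h a = ∑ i, h (f i) := by
  rw [mem_SS] at hf
  simp only [cnt, Nat.cast_sum, Finset.sum_mul, Nat.cast_ite, Nat.cast_one, Nat.cast_zero, ite_mul,
    one_mul, zero_mul]
  rw [Finset.sum_comm]
  refine Finset.sum_congr rfl fun i _ => ?_
  rw [Finset.sum_ite_eq, if_pos]
  have := hf i
  have := i.isLt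
  simp; omega

def XX {t : ℕ} (f : Fin t → ℕ) : ℝ := ∑ i, (f i : ℝ)
def YY {t : ℕ} (f : Fin t → ℕ) : ℝ := ∑ i, (f i : ℝ) ^ 2

lemma XX_snoc {t : ℕ} (f : Fin t → ℕ) (a : ℕ) :
    XX (Fin.snoc f a : Fin (t + 1) → ℕ) = XX f + a := by
  simp [XX, Fin.sum_univ_castSucc]
lemma YY_snoc {t : ℕ} (f : Fin t → ℕ) (a : ℕ) :
    YY (Fin.snoc f a : Fin (t + 1) → ℕ) = YY f + (a : ℝ) ^ 2 := by
  simp [YY, Fin.sum_univ_castSucc]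

lemma gauss1 (t : ℕ) : ∑ a ∈ range (t + 1), (a : ℝ) = t * (t + 1) / 2 := by
  induction t with
  | zero => simp
  | succ t ih => rw [Finset.sum_range_succ, ih]; push_cast; ring
lemma gauss2 (t : ℕ) : ∑ a ∈ range (t + 1), (a : ℝ) ^ 2 = t * (t + 1) * (2 * t + 1) / 6 := by
  induction t with
  | zero => simp
  | succ t ih => rw [Finset.sum_range_succ, ih]; push_cast; ring

lemma free0 {t : ℕ} {f : Fin t → ℕ} (hf : f ∈ SS t) :
    ∑ a ∈ range (t + 1), (2 - (cnt f a : ℝ)) = t + 2 := by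
  have := sum_cnt hf (fun _ => 1)
  simp only [mul_one] at this
  rw [Finset.sum_sub_distrib, this]
  simp; ring
lemma free1 {t : ℕ} {f : Fin t → ℕ} (hf : f ∈ SS t) :
    ∑ a ∈ range (t + 1), (2 - (cnt f a : ℝ)) * a = t * (t + 1) - XX f := by
  have := sum_cnt hf (fun a => (a : ℝ))
  simp only [sub_mul]
  rw [Finset.sum_sub_distrib, this, ← Finset.mul_sum, gauss1, XX]
  ring
lemma free2 {t : ℕ} {f : Fin t → ℕ} (hf : f ∈ SS t) :
    ∑ a ∈ range (t + 1), (2 - (cnt f a : ℝ)) * (a : ℝ) ^ 2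
      = t * (t + 1) * (2 * t + 1) / 3 - YY f := by
  have := sum_cnt hf (fun a => (a : ℝ) ^ 2)
  simp only [sub_mul]
  rw [Finset.sum_sub_distrib, this, ← Finset.mul_sum, gauss2, YY]
  ring

/-- one step of the recursion for weighted sums of quadratic polynomials -/
lemma step (t : ℕ) (H : (Fin (t + 1) → ℕ) → ℝ) (A B C : (Fin t → ℕ) → ℝ)
    (hH : ∀ f a, H (Fin.snoc f a : Fin (t + 1) → ℕ) = A f + B f * (a : ℝ) + C f * (a : ℝ) ^ 2) :
    ∑ g ∈ SS (t + 1), wt (t + 1) g * H g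
      = ∑ f ∈ SS t, wt t f * (A f * (t + 2) + B f * (t * (t + 1) - XX f)
          + C f * (t * (t + 1) * (2 * t + 1) / 3 - YY f)) := by
  rw [sum_SS_succ]
  refine Finset.sum_congr rfl fun f hf => ?_
  rw [← free0 hf, ← free1 hf, ← free2 hf, Finset.mul_sum, Finset.mul_sum, Finset.mul_sum,
    ← Finset.sum_add_distrib, ← Finset.sum_add_distrib, Finset.mul_sum]
  refine Finset.sum_congr rfl fun a ha => ?_
  rw [wt_snoc hf ha, hH]
  ring

lemma moments (t : ℕ) :
    (∑ f ∈ SS t, wt t f = (Nat.factorial (t + 1) : ℝ)) ∧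
    (∑ f ∈ SS t, wt t f * XX f = (Nat.factorial (t + 1) : ℝ) * (t * (t - 1) / 3)) ∧
    (∑ f ∈ SS t, wt t f * YY f = (Nat.factorial (t + 1) : ℝ) * (t ^ 2 * (t - 1) / 6)) ∧
    (∑ f ∈ SS t, wt t f * (XX f) ^ 2 = (Nat.factorial (t + 1) : ℝ) *
      ((t + 2) * (t + 3) * (t - 1) / 90 + (t * (t - 1) / 3) ^ 2 + if t = 0 then 6 / 90 else 0)) := by
  induction t with
  | zero =>
    have h0 : SS 0 = {Fin.elim0} := by
      ext f; simp [mem_SS]; exact Subsingleton.elim _ _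
    simp [h0, wt, cnt, Dw, XX, YY]
    norm_num
  | succ t ih =>
    obtain ⟨i1, i2, i3, i4⟩ := ih
    have hf : (Nat.factorial (t + 1 + 1) : ℝ) = (t + 2) * Nat.factorial (t + 1) := by
      rw [Nat.factorial_succ (t + 1)]; push_cast; ring
    refine ⟨?_, ?_, ?_, ?_⟩
    · have := step t (fun _ => 1) (fun _ => 1) (fun _ => 0) (fun _ => 0) (by simp)
      simp only [mul_one, one_mul, zero_mul, add_zero, ← Finset.sum_mul, i1] at this
      rw [this, hf]; ring
    · rw [step t XX XX (fun _ => 1) (fun _ => 0) (by intro f a; rw [XX_snoc]; ring)]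
      have : ∀ f ∈ SS t, wt t f * (XX f * (t + 2) + 1 * (t * (t + 1) - XX f)
          + 0 * (t * (t + 1) * (2 * t + 1) / 3 - YY f))
          = (wt t f * XX f) * (t + 1) + wt t f * (t * (t + 1)) := by intros; ring
      rw [Finset.sum_congr rfl this, Finset.sum_add_distrib, ← Finset.sum_mul, ← Finset.sum_mul,
        i1, i2, hf]
      push_cast; ring
    · rw [step t YY YY (fun _ => 0) (fun _ => 1) (by intro f a; rw [YY_snoc]; ring)]
      have : ∀ f ∈ SS t, wt t f * (YY f * (t + 2) + 0 * (t * (t + 1) - XX f)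
          + 1 * (t * (t + 1) * (2 * t + 1) / 3 - YY f))
          = (wt t f * YY f) * (t + 1) + wt t f * (t * (t + 1) * (2 * t + 1) / 3) := by intros; ring
      rw [Finset.sum_congr rfl this, Finset.sum_add_distrib, ← Finset.sum_mul, ← Finset.sum_mul,
        i1, i3, hf]
      push_cast; ring
    · rw [step t (fun f => XX f ^ 2) (fun f => XX f ^ 2) (fun f => 2 * XX f) (fun _ => 1)
        (by intro f a; rw [XX_snoc]; ring)]
      have : ∀ f ∈ SS t, wt t f * (XX f ^ 2 * (t + 2) + 2 * XX f * (t * (t + 1) - XX f)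
          + 1 * (t * (t + 1) * (2 * t + 1) / 3 - YY f))
          = (wt t f * XX f ^ 2) * t + (wt t f * XX f) * (2 * t * (t + 1)) - wt t f * YY f
            + wt t f * (t * (t + 1) * (2 * t + 1) / 3) := by intros; ring
      rw [Finset.sum_congr rfl this, Finset.sum_add_distrib, Finset.sum_sub_distrib,
        Finset.sum_add_distrib, ← Finset.sum_mul, ← Finset.sum_mul, ← Finset.sum_mul,
        i1, i2, i3, i4, hf]
      rw [if_neg (Nat.succ_ne_zero t)]
      rcases eq_or_ne t 0 with h | h
      · subst h; norm_num
      · rw [if_neg h]; push_cast; ring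

lemma count_eq (n : ℕ) (T : UCOM n) (s : Fin (n - 1)) (hs : (s : ℕ) ≠ 0) :
    (s : ℕ) ≤ Ix n T s ∧ Ix n T s < n - 1 ∧
    ∀ k : Fin (n - 1), (uraw n T k).count s = if Ix n T s = (k : ℕ) then 1 else 0 := by
  obtain ⟨h1, h2, h3⟩ := T.2
  have hsum : ∑ k, (uraw n T k).count s = 1 := by
    have := h2 s
    rw [if_neg hs] at this
    exact this
  obtain ⟨k0, -, hk0⟩ : ∃ k ∈ (Finset.univ : Finset (Fin (n - 1))), (uraw n T k).count s ≠ 0 := by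
    apply Finset.exists_ne_zero_of_sum_ne_zero
    omega
  have hk : ∀ k, (uraw n T k).count s = if k = k0 then 1 else 0 := by
    rw [← Finset.add_sum_erase _ _ (Finset.mem_univ k0)] at hsum
    have hz : ∑ k ∈ Finset.univ.erase k0, (uraw n T k).count s = 0 := by omega
    rw [Finset.sum_eq_zero_iff] at hz
    intro k
    split_ifs with h
    · subst h; omega
    · exact hz k (by simp [h])
  have hI : Ix n T s = (k0 : ℕ) := by
    have : {k : ℕ | ∃ h : k < n - 1, s ∈ uraw n T ⟨k, h⟩} = {(k0 : ℕ)} := by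
      ext k
      simp only [Set.mem_ofPred_eq, Set.mem_singleton_iff]
      constructor
      · rintro ⟨h, hm⟩
        have := Multiset.count_ne_zero.2 hm
        rw [hk] at this
        by_contra hne
        rw [if_neg (by intro h'; apply hne; rw [← h'])] at this
        exact this rfl
      · intro h
        subst h
        exact ⟨k0.2, Multiset.count_ne_zero.1 hk0⟩
    rw [Ix, this, csInf_singleton]
  refine ⟨?_, by rw [hI]; exact k0.2, ?_⟩
  · rw [hI]
    exact h3 s k0 hs (Multiset.count_ne_zero.1 hk0)
  · intro k
    rw [hk, hI]
    simp only [Fin.ext_iff, eq_comm]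

lemma sum_count_two (n : ℕ) (T : UCOM n) (k : Fin (n - 1)) :
    ∑ s, (uraw n T k).count s = 2 := by
  rw [← T.2.1 k]
  exact Multiset.sum_count_eq_card (by simp)

def lab {t : ℕ} (i : Fin t) : Fin (t + 2 - 1) := ⟨t - i, by omega⟩

lemma sum_lab {M : Type*} [AddCommMonoid M] (t : ℕ) (h : Fin (t + 2 - 1) → M) :
    ∑ s ∈ Finset.univ.filter (fun j : Fin (t + 2 - 1) => (j : ℕ) ≠ 0), h s
      = ∑ i : Fin t, h (lab i) := by
  symm
  refine Finset.sum_bij (fun i _ => lab i) ?_ ?_ ?_ ?_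
  · intro i _
    have := i.isLt
    simp [lab]; omega
  · intro i _ j _ hij
    simp only [lab, Fin.mk.injEq] at hij
    ext; omega
  · intro s hs
    simp only [Finset.mem_filter, Finset.mem_univ, true_and] at hs
    have := s.isLt
    refine ⟨⟨t - s, by omega⟩, Finset.mem_univ _, ?_⟩
    ext; simp [lab]; omega
  · intros; rfl

lemma sum_split {M : Type*} [AddCommMonoid M] (t : ℕ) (h : Fin (t + 2 - 1) → M) :
    ∑ s, h s = h ⟨0, by omega⟩ + ∑ i : Fin t, h (lab i) := by
  rw [← sum_lab, ← Finset.sum_filter_add_sum_filter_not Finset.univ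
    (fun j : Fin (t + 2 - 1) => (j : ℕ) = 0)]
  congr 1
  rw [Finset.sum_eq_single ⟨0, by omega⟩]
  · intro b hb hb'
    simp only [Finset.mem_filter, Finset.mem_univ, true_and] at hb
    exact absurd (Fin.ext hb) hb'
  · simp

noncomputable def fT (t : ℕ) (T : UCOM (t + 2)) : Fin t → ℕ := fun i => t - Ix (t + 2) T (lab i)

lemma lab_ne {t : ℕ} (i : Fin t) : (lab i : ℕ) ≠ 0 := by
  have := i.isLt
  simp only [lab]; omega

lemma fT_mem (t : ℕ) (T : UCOM (t + 2)) : fT t T ∈ SS t := by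
  rw [mem_SS]
  intro i
  have h1 := (count_eq _ T (lab i) (lab_ne i)).1
  have h2 := i.isLt
  have h3 : (lab i : ℕ) = t - i := rfl
  simp only [fT]
  omega

lemma sum_count_lab (t : ℕ) (T : UCOM (t + 2)) (k : Fin (t + 2 - 1)) :
    ∑ i : Fin t, (uraw _ T k).count (lab i) = cnt (fT t T) (t - k) := by
  unfold cnt
  refine Finset.sum_congr rfl fun i _ => ?_
  obtain ⟨h1, h2, h3⟩ := count_eq _ T (lab i) (lab_ne i)
  rw [h3]
  have := k.isLt
  simp only [fT]
  congr 1
  apply propext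
  omega

lemma count_zero_add (t : ℕ) (T : UCOM (t + 2)) (k : Fin (t + 2 - 1)) :
    (uraw _ T k).count ⟨0, by omega⟩ + cnt (fT t T) (t - k) = 2 := by
  rw [← sum_count_lab, ← sum_split t (fun s => (uraw _ T k).count s), sum_count_two]

lemma cherry_iff (t : ℕ) (T : UCOM (t + 2)) (k : Fin (t + 2 - 1)) :
    (∀ a ∈ uraw _ T k, (a : ℕ) = 0) ↔ cnt (fT t T) (t - k) = 0 := by
  rw [← sum_count_lab, ← sum_lab t (fun s => (uraw _ T k).count s), Finset.sum_eq_zero_iff]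
  simp only [Finset.mem_filter, Finset.mem_univ, true_and, Multiset.count_eq_zero]
  constructor
  · intro h a ha hm
    exact ha (h a hm)
  · intro h a hm
    by_contra hne
    exact h a hne hm

lemma prod_reflect (t : ℕ) (h : ℕ → ℝ) :
    ∏ q ∈ range (t + 1), h q = ∏ k : Fin (t + 2 - 1), h (t - k) := by
  rw [← Finset.prod_range_reflect]
  exact Finset.prod_range (fun k => h (t + 1 - 1 - k))

lemma sum_reflect (t : ℕ) (h : ℕ → ℝ) :
    ∑ q ∈ range (t + 1), h q = ∑ k : Fin (t + 2 - 1), h (t - k) := by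
  rw [← Finset.sum_range_reflect]
  exact Finset.sum_range (fun k => h (t + 1 - 1 - k))

lemma wt_fT (t : ℕ) (T : UCOM (t + 2)) :
    wt t (fT t T) = (2 : ℝ) ^ (t + 2 - cherries (t + 2) T - 1) := by
  unfold wt
  rw [prod_reflect]
  have : ∀ k : Fin (t + 2 - 1), Dw (cnt (fT t T) (t - k))
      = if (∀ a ∈ uraw _ T k, (a : ℕ) = 0) then 1 else 2 := by
    intro k
    have h2 := count_zero_add t T k
    have h3 := cherry_iff t T k
    by_cases h : cnt (fT t T) (t - k) = 0
    · rw [if_pos (h3.2 h), h, Dw_zero]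
    · rw [if_neg (fun h' => h (h3.1 h'))]
      have : cnt (fT t T) (t - k) = 1 ∨ cnt (fT t T) (t - k) = 2 := by omega
      rcases this with h | h <;> rw [h]
      · exact Dw_one
      · exact Dw_two
  rw [Finset.prod_congr rfl fun k _ => this k, Finset.prod_ite]
  simp only [Finset.prod_const, one_pow, one_mul]
  congr 1
  have := Finset.card_filter_add_card_filter_not (s := (Finset.univ : Finset (Fin (t + 2 - 1))))
    (fun k => ∀ a ∈ uraw _ T k, (a : ℕ) = 0)
  rw [Finset.card_univ, Fintype.card_fin] at this
  unfold cherries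
  omega

lemma itl_fT (t : ℕ) (T : UCOM (t + 2)) :
    (itl (t + 2) T : ℝ) = t * (t + 1) / 2 - XX (fT t T) := by
  unfold itl
  rw [sum_lab]
  have h : ∀ i : Fin t, ((Ix (t + 2) T (lab i) : ℤ) + 1 - ((lab i : ℕ) : ℤ))
      = ((i : ℕ) : ℤ) + 1 - (fT t T i : ℤ) := by
    intro i
    obtain ⟨h1, h2, -⟩ := count_eq _ T (lab i) (lab_ne i)
    have := i.isLt
    simp only [fT]
    simp only [lab] at *
    omega
  rw [Finset.sum_congr rfl fun i _ => h i]
  push_cast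
  rw [Finset.sum_sub_distrib, XX]
  congr 1
  rw [Fin.sum_univ_eq_sum_range (fun i => (i : ℝ) + 1), ← gauss1, Finset.sum_range_succ']
  simp

lemma fT_inj (t : ℕ) (T T' : UCOM (t + 2)) (h : fT t T = fT t T') : T = T' := by
  apply Subtype.ext
  funext k
  apply Sym.coe_injective
  change uraw _ T k = uraw _ T' k
  ext s
  by_cases hs : (s : ℕ) = 0
  · have h1 := count_zero_add t T k
    have h2 := count_zero_add t T' k
    have : s = ⟨0, by omega⟩ := Fin.ext hs
    rw [this]
    rw [h] at h1
    omega
  · obtain ⟨a1, a2, a3⟩ := count_eq _ T s hs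
    obtain ⟨b1, b2, b3⟩ := count_eq _ T' s hs
    rw [a3, b3]
    have hsl := s.isLt
    have := congrFun h ⟨t - s, by omega⟩
    have hl : lab (⟨t - s, by omega⟩ : Fin t) = s := by
      ext; simp only [lab]; omega
    simp only [fT, hl] at this
    have : Ix (t + 2) T s = Ix (t + 2) T' s := by omega
    rw [this]

def mlt {t : ℕ} (f : Fin t → ℕ) (k s : Fin (t + 2 - 1)) : ℕ :=
  if (s : ℕ) = 0 then 2 - cnt f (t - k)
  else if h : t - (s : ℕ) < t then (if f ⟨t - s, h⟩ = t - k then 1 else 0) else 0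

lemma mlt_zero {t : ℕ} (f : Fin t → ℕ) (k : Fin (t + 2 - 1)) :
    mlt f k ⟨0, by omega⟩ = 2 - cnt f (t - k) := by simp [mlt]

lemma mlt_lab {t : ℕ} (f : Fin t → ℕ) (k : Fin (t + 2 - 1)) (i : Fin t) :
    mlt f k (lab i) = if f i = t - k then 1 else 0 := by
  have hi := i.isLt
  unfold mlt
  rw [if_neg (lab_ne i), dif_pos (by simp only [lab]; omega)]
  have : (⟨t - (lab i : ℕ), by simp only [lab]; omega⟩ : Fin t) = i := by
    ext; simp only [lab]; omega
  rw [this]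

lemma exists_lab {t : ℕ} (s : Fin (t + 2 - 1)) (hs : (s : ℕ) ≠ 0) : ∃ i : Fin t, s = lab i := by
  have hsl := s.isLt
  refine ⟨⟨t - s, by omega⟩, ?_⟩
  ext; simp only [lab]; omega

lemma fT_surj (t : ℕ) (f : Fin t → ℕ) (hf : f ∈ SS t) (hw : wt t f ≠ 0) :
    ∃ T : UCOM (t + 2), fT t T = f := by
  have hc : ∀ q ∈ range (t + 1), cnt f q ≤ 2 := by
    intro q hq
    by_contra hlt
    exact (Finset.prod_ne_zero_iff.1 hw q hq) (Dw_ge _ (by omega))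
  have hck : ∀ k : Fin (t + 2 - 1), cnt f (t - k) ≤ 2 := fun k => hc _ (by simp)
  have hfm := mem_SS.1 hf
  let p : Fin (t + 2 - 1) → Multiset (Fin (t + 2 - 1)) :=
    fun k => ∑ s, Multiset.replicate (mlt f k s) s
  have pc : ∀ k s, (p k).count s = mlt f k s := by
    intro k s
    simp only [p, Multiset.count_sum', Multiset.count_replicate]
    simp
  have pcard : ∀ k, Multiset.card (p k) = 2 := by
    intro k
    simp only [p, Multiset.card_sum, Multiset.card_replicate]
    rw [sum_split, mlt_zero]
    simp only [mlt_lab]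
    have := hck k
    change 2 - cnt f (t - k) + cnt f (t - k) = 2
    omega
  have hraw : IsUCOMraw (t + 2) p := by
    refine ⟨pcard, ?_, ?_⟩
    · intro s
      simp only [pc]
      split_ifs with hs
      · have : s = ⟨0, by omega⟩ := Fin.ext hs
        rw [this]
        simp only [mlt_zero]
        have h0 := free0 hf
        rw [sum_reflect t (fun a => 2 - (cnt f a : ℝ))] at h0
        have : ((∑ k : Fin (t + 2 - 1), (2 - cnt f (t - k)) : ℕ) : ℝ) = ((t + 2 : ℕ) : ℝ) := by
          push_cast
          rw [← h0]
          refine Finset.sum_congr rfl fun k _ => ?_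
          rw [Nat.cast_sub (hck k)]
          simp
        exact_mod_cast this
      · obtain ⟨i, rfl⟩ := exists_lab s hs
        simp only [mlt_lab]
        have h1 := hfm i
        have h2 := i.isLt
        rw [Finset.sum_eq_single ⟨t - f i, by omega⟩]
        · rw [if_pos]; simp only; omega
        · intro b _ hb
          rw [if_neg]
          intro h
          have := b.isLt
          apply hb
          ext; simp only; omega
        · simp
    · intro j k hj hm
      obtain ⟨i, rfl⟩ := exists_lab j hj
      have := Multiset.count_ne_zero.2 hm
      rw [pc, mlt_lab] at this
      have h3 : f i = t - k := by
        by_contra h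
        rw [if_neg h] at this
        exact this rfl
      have h1 := hfm i
      have h2 := i.isLt
      have := k.isLt
      simp only [lab]
      omega
  refine ⟨⟨fun k => ⟨p k, pcard k⟩, hraw⟩, ?_⟩
  set T : UCOM (t + 2) := ⟨fun k => ⟨p k, pcard k⟩, hraw⟩ with hT
  have hu : ∀ k, uraw _ T k = p k := fun k => rfl
  funext i
  obtain ⟨a1, a2, a3⟩ := count_eq _ T (lab i) (lab_ne i)
  have h1 := hfm i
  have h2 := i.isLt
  have h3 := a3 ⟨t - f i, by omega⟩
  rw [hu, pc, mlt_lab, if_pos (by simp only; omega)] at h3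
  have h4 : Ix (t + 2) T (lab i) = t - f i := by
    by_contra h
    rw [if_neg h] at h3
    omega
  simp only [fT, h4]
  omega

lemma bridge (t : ℕ) (g : ℝ → ℝ) :
    ∑ T : UCOM (t + 2), tajima (t + 2) T * g (itl (t + 2) T)
      = (∑ f ∈ SS t, wt t f * g (t * (t + 1) / 2 - XX f)) / (Nat.factorial (t + 1) : ℝ) := by
  rw [Finset.sum_div]
  rw [← Finset.sum_filter_of_ne (p := fun f => wt t f ≠ 0) (s := SS t)]
  swap
  · intro f _ h hw
    apply h; rw [hw]; simp
  refine Finset.sum_bij (fun T _ => fT t T) ?_ ?_ ?_ ?_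
  · intro T _
    rw [Finset.mem_filter]
    refine ⟨fT_mem t T, ?_⟩
    rw [wt_fT]; positivity
  · intro T _ T' _ h
    exact fT_inj t T T' h
  · intro f hf
    rw [Finset.mem_filter] at hf
    obtain ⟨T, hT⟩ := fT_surj t f hf.1 hf.2
    exact ⟨T, Finset.mem_univ _, hT⟩
  · intro T _
    rw [wt_fT, ← itl_fT, tajima]
    change _ / (Nat.factorial (t + 1) : ℝ) * _ = _
    ring

/-- For `n ≥ 3`, under the Tajima distribution on `COM_n`, the variance of
the internal tree length is `n(n+1)(n−3)/90`. -/
theorem stmt14 (n : ℕ) (hn : 3 ≤ n) :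
    (∑ T : UCOM n, tajima n T * (itl n T : ℝ) ^ 2) -
        (∑ T : UCOM n, tajima n T * (itl n T : ℝ)) ^ 2
      = (n : ℝ) * ((n : ℝ) + 1) * ((n : ℝ) - 3) / 90 := by
  obtain ⟨t, rfl⟩ : ∃ t, n = t + 2 := ⟨n - 2, by omega⟩
  have ht : t ≠ 0 := by omega
  have hF : (Nat.factorial (t + 1) : ℝ) ≠ 0 := by positivity
  obtain ⟨i1, i2, -, i4⟩ := moments t
  rw [if_neg ht] at i4
  rw [bridge t (fun x => x ^ 2), bridge t (fun x => x)]
  have e1 : ∑ f ∈ SS t, wt t f * ((t : ℝ) * (t + 1) / 2 - XX f)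
      = (∑ f ∈ SS t, wt t f) * ((t : ℝ) * (t + 1) / 2) - ∑ f ∈ SS t, wt t f * XX f := by
    rw [Finset.sum_mul, ← Finset.sum_sub_distrib]
    exact Finset.sum_congr rfl fun f _ => by ring
  have e2 : ∑ f ∈ SS t, wt t f * ((t : ℝ) * (t + 1) / 2 - XX f) ^ 2
      = (∑ f ∈ SS t, wt t f) * ((t : ℝ) * (t + 1) / 2) ^ 2
        - (∑ f ∈ SS t, wt t f * XX f) * (t * (t + 1)) + ∑ f ∈ SS t, wt t f * XX f ^ 2 := by
    rw [Finset.sum_mul, Finset.sum_mul, ← Finset.sum_sub_distrib, ← Finset.sum_add_distrib]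
    exact Finset.sum_congr rfl fun f _ => by ring
  rw [e1, e2, i1, i2, i4]
  push_cast
  field_simp
  ring
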